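/- Fix an integer k ≥ 1 and let q^k(n) denote the k-fold iterate of the n-th prime function applied to n (so q^1(n) = p_n, q^2(n) = p_{p_n}, q^3(n) = p_{p_{p_n}}, etc.). Then q^k(n) ~ n·(log n)^k as n → ∞, i.e. the ratio q^k(n) / (n·(log n)^k) tends to 1. -/

import Mathlib

open Filter Real

/-- `nthPrime n` is the `n`-th prime with 1-based indexing: `nthPrime 1 = 2`. -/
noncomputable def nthPrime (n : ℕ) : ℕ := Nat.nth Nat.Prime (n - 1)

/-- `q k n` is the prime-indexed prime of prime-index order `k`:
`q 0 n = n` and `q (k+1) n = p_{q k n}`. -/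
noncomputable def q (k n : ℕ) : ℕ := nthPrime^[k] n

open MeasureTheory Topology Set

/-- The Fejér kernel on the real line. -/
noncomputable def fejerKernel (x : ℝ) : ℝ := sinc (x / 2) ^ 2

theorem fejerKernel_nonneg (x : ℝ) : 0 ≤ fejerKernel x := sq_nonneg _

theorem continuous_fejerKernel : Continuous fejerKernel :=
  (continuous_sinc.comp (continuous_id.div_const 2)).pow 2

theorem fejerKernel_le (x : ℝ) : fejerKernel x ≤ 5 * (1 + x ^ 2)⁻¹ := by
  have h1 : fejerKernel x ≤ 1 := (sq_le_one_iff_abs_le_one _).2 (abs_sinc_le_one _)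
  have h2 : fejerKernel x * x ^ 2 ≤ 4 := by
    rcases eq_or_ne x 0 with rfl | hx
    · simp
    · rw [fejerKernel, sinc_of_ne_zero (by simpa using hx)]
      have := sin_sq_le_one (x / 2)
      field_simp
      linarith
  rw [← div_eq_mul_inv, le_div_iff₀ (by positivity)]
  linarith

theorem integrable_fejerKernel : Integrable fejerKernel :=
  (integrable_inv_one_add_sq.const_mul 5).mono' continuous_fejerKernel.aestronglyMeasurable
    (ae_of_all _ fun x ↦ by
      rw [norm_of_nonneg (fejerKernel_nonneg x)]; exact fejerKernel_le x)

theorem integral_fejerKernel_pos : 0 < ∫ x, fejerKernel x :=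
  integral_pos_of_integrable_nonneg_nonzero (x := 0) continuous_fejerKernel integrable_fejerKernel
    fejerKernel_nonneg (by simp [fejerKernel])

theorem fejerKernel_eq_integral (x : ℝ) :
    (fejerKernel x : ℂ) =
      ∫ y in Icc (-1 : ℝ) 1, ((1 - |y| : ℝ) : ℂ) * Complex.exp (x * y * Complex.I) := by
  have hc : Continuous fun y : ℝ ↦ ((1 - |y| : ℝ) : ℂ) * Complex.exp (x * y * Complex.I) := by
    fun_prop
  rw [integral_Icc_eq_integral_Ioc, ← intervalIntegral.integral_of_le (by norm_num),
    ← intervalIntegral.integral_add_adjacent_intervals (hc.intervalIntegrable (-1) 0)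
      (hc.intervalIntegrable 0 1)]
  have h1 : ∫ y in (-1 : ℝ)..0, ((1 - |y| : ℝ) : ℂ) * Complex.exp (x * y * Complex.I) =
      ∫ y in (0 : ℝ)..1, ((1 - |y| : ℝ) : ℂ) * Complex.exp (-(x * y * Complex.I)) := by
    rw [← neg_zero, ← intervalIntegral.integral_comp_neg]
    simp
  rw [h1, ← intervalIntegral.integral_add (by apply Continuous.intervalIntegrable; fun_prop)
    (hc.intervalIntegrable 0 1)]
  have h2 : ∫ y in (0 : ℝ)..1, (((1 - |y| : ℝ) : ℂ) * Complex.exp (-(x * y * Complex.I)) +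
      ((1 - |y| : ℝ) : ℂ) * Complex.exp (x * y * Complex.I)) =
      ∫ y in (0 : ℝ)..1, ((2 * (1 - y) * cos (x * y) : ℝ) : ℂ) := by
    refine intervalIntegral.integral_congr fun y hy ↦ ?_
    rw [uIcc_of_le zero_le_one] at hy
    simp only [abs_of_nonneg hy.1]
    push_cast
    rw [Complex.cos]
    ring_nf
  rw [h2, intervalIntegral.integral_ofReal]
  congr 1
  rcases eq_or_ne x 0 with rfl | hx
  · have h3 : ∫ y in (0 : ℝ)..1, (1 - y) = 1 / 2 := by
      rw [intervalIntegral.integral_sub (by simp) (by simp)]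
      norm_num
    simp [fejerKernel, h3]
  · have hd (y : ℝ) : HasDerivAt (fun y ↦ 2 * (1 - y) * sin (x * y) / x - 2 * cos (x * y) / x ^ 2)
        (2 * (1 - y) * cos (x * y)) y := by
      have h3 : HasDerivAt (fun y : ℝ ↦ x * y) x y := by simpa using (hasDerivAt_id y).const_mul x
      have h4 : HasDerivAt (fun y : ℝ ↦ 2 * (1 - y)) (-2) y := by
        simpa using ((hasDerivAt_id y).const_sub 1).const_mul 2
      convert! ((h4.mul h3.sin).div_const x).sub ((h3.cos.const_mul 2).div_const (x ^ 2)) using 1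
      field_simp
      ring
    rw [intervalIntegral.integral_eq_sub_of_hasDerivAt (fun y _ ↦ hd y)
      (by apply Continuous.intervalIntegrable; fun_prop), fejerKernel,
      sinc_of_ne_zero (by simpa using hx), div_pow, sin_sq_eq_half_sub]
    have : 2 * (x / 2) = x := by ring
    rw [this]
    simp
    field_simp
    ring

/-- If a nonnegative bounded function `H`, for which `H u * exp u` is monotone, has averages against
all rescalings of an integrable kernel `K` tending to `1`, then `H` itself tends to `1`. -/
theorem tendsto_one_of_tendsto_kernel_average {K H : ℝ → ℝ} {C : ℝ} (hK : Integrable K)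
    (hK0 : ∀ x, 0 ≤ K x) (hA : 0 < ∫ x, K x) (hH0 : ∀ u, 0 ≤ H u) (hHC : ∀ u, H u ≤ C)
    (hmono : Monotone fun u ↦ H u * exp u)
    (hlim : ∀ r > 0, Tendsto (fun t ↦ ∫ v, H (t - v / r) * K v) atTop (𝓝 (∫ x, K x))) :
    Tendsto H atTop (𝓝 1) := by
  have hHm : Measurable H := by
    have : H = fun u ↦ (H u * exp u) * exp (-u) := by
      ext u; rw [mul_assoc, ← exp_add]; simp
    rw [this]
    exact hmono.measurable.mul (by fun_prop)
  set A := ∫ x, K x with hAdef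
  have hC : 0 ≤ C := (hH0 0).trans (hHC 0)
  have hint (r t : ℝ) : Integrable fun v ↦ H (t - v / r) * K v := by
    refine hK.bdd_mul (c := C) (hHm.comp (by fun_prop)).aestronglyMeasurable (ae_of_all _ fun v ↦ ?_)
    rw [norm_of_nonneg (hH0 _)]
    exact hHC _
  have hle {u v : ℝ} {d : ℝ} (huv : u ≤ v) (hd : v ≤ u + d) : H u ≤ H v * exp d := by
    have h1 : H u * exp u ≤ H v * exp v := hmono huv
    have h2 : H v * exp v ≤ H v * exp d * exp u := by
      rw [mul_assoc, ← exp_add]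
      gcongr
      · exact hH0 v
      · linarith
    exact le_of_mul_le_mul_right (h1.trans h2) (exp_pos u)
  have hAM : Tendsto (fun M : ℝ ↦ ∫ x in Ioc (-M) M, K x) atTop (𝓝 A) := by
    refine (intervalIntegral_tendsto_integral hK tendsto_neg_atTop_atBot tendsto_id).congr' ?_
    filter_upwards [eventually_ge_atTop 0] with M hM
    rw [intervalIntegral.integral_of_le (by simp only [id]; linarith), id]
  have hexp (c : ℝ) : Tendsto (fun d : ℝ ↦ c * exp (2 * d)) (𝓝[>] 0) (𝓝 c) := by
    refine tendsto_nhdsWithin_of_tendsto_nhds ?_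
    have : Continuous fun d : ℝ ↦ c * exp (2 * d) := by fun_prop
    simpa using this.tendsto 0
  rw [tendsto_order]
  constructor
  · intro a ha
    have h1 : Tendsto (fun M : ℝ ↦ A - C * (A - ∫ x in Ioc (-M) M, K x)) atTop (𝓝 A) := by
      have h := (((tendsto_const_nhds (x := A)).sub hAM).const_mul C).const_sub A
      rwa [sub_self, mul_zero, sub_zero] at h
    obtain ⟨M, hM, hM0⟩ := ((h1.eventually (lt_mem_nhds (show a * A < A by nlinarith))).and
      (eventually_gt_atTop 0)).exists
    obtain ⟨d, hd, hd0⟩ := (((hexp (a * A)).eventually (gt_mem_nhds hM)).and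
      self_mem_nhdsWithin).exists
    have hd0 : 0 < d := hd0
    have h2 := ((hlim (M / d) (by positivity)).comp (tendsto_atTop_add_const_right atTop (-d)
      tendsto_id)).eventually (lt_mem_nhds (show
        a * A * exp (2 * d) + C * (A - ∫ x in Ioc (-M) M, K x) < A by linarith))
    filter_upwards [h2] with t ht
    simp only [Function.comp_apply, id] at ht
    have hS : ∫ x in (Ioc (-M) M)ᶜ, K x = A - ∫ x in Ioc (-M) M, K x := by
      rw [hAdef, ← integral_add_compl measurableSet_Ioc hK]; ring
    have hub : ∫ v, H (t + -d - v / (M / d)) * K v ≤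
        ∫ v, (H t * exp (2 * d) * K v + C * (Ioc (-M) M)ᶜ.indicator K v) := by
      refine integral_mono (hint _ _) ((hK.const_mul _).add
        ((hK.indicator measurableSet_Ioc.compl).const_mul _)) fun v ↦ ?_
      by_cases hv : v ∈ Ioc (-M) M
      · simp only [mem_compl_iff, hv, not_true_eq_false, not_false_eq_true, indicator_of_notMem,
          mul_zero, add_zero]
        refine mul_le_mul_of_nonneg_right (hle ?_ ?_) (hK0 v)
        · have : -d ≤ v / (M / d) := by
            rw [le_div_iff₀ (by positivity)]; field_simp; linarith [hv.1]
          linarith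
        · have : v / (M / d) ≤ d := by
            rw [div_le_iff₀ (by positivity)]; field_simp; linarith [hv.2]
          linarith
      · have := mul_le_mul_of_nonneg_right (hHC (t + -d - v / (M / d))) (hK0 v)
        have := mul_nonneg (mul_nonneg (hH0 t) (exp_pos (2 * d)).le) (hK0 v)
        simp only [mem_compl_iff, hv, not_false_eq_true, indicator_of_mem]
        linarith
    rw [integral_add (hK.const_mul _) ((hK.indicator measurableSet_Ioc.compl).const_mul _),
      integral_const_mul, integral_const_mul, integral_indicator measurableSet_Ioc.compl, hS,
      ← hAdef] at hub
    have h3 : a * A * exp (2 * d) < H t * exp (2 * d) * A := by linarith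
    have h4 : 0 < exp (2 * d) * A := by positivity
    by_contra! hcon
    nlinarith
  · intro a ha
    have ha0 : 0 < a := by linarith
    obtain ⟨M, hM, hM0⟩ := ((hAM.eventually (lt_mem_nhds (div_lt_self hA ha))).and
      (eventually_gt_atTop 0)).exists
    rw [div_lt_iff₀ ha0] at hM
    obtain ⟨d, hd, hd0⟩ := (((hexp A).eventually (gt_mem_nhds hM)).and self_mem_nhdsWithin).exists
    have hd0 : 0 < d := hd0
    set B := ∫ x in Ioc (-M) M, K x
    have hB : 0 < B := by
      have : 0 < B * a := hA.trans hM
      exact pos_of_mul_pos_left this ha0.le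
    have h2 := ((hlim (M / d) (by positivity)).comp (tendsto_atTop_add_const_right atTop d
      tendsto_id)).eventually (gt_mem_nhds (show A < B * a / exp (2 * d) by
        rwa [lt_div_iff₀ (exp_pos _)]))
    filter_upwards [h2] with t ht
    simp only [Function.comp_apply, id] at ht
    rw [lt_div_iff₀ (exp_pos _)] at ht
    have hlb : ∫ v in Ioc (-M) M, H t * K v ≤
        ∫ v in Ioc (-M) M, exp (2 * d) * (H (t + d - v / (M / d)) * K v) := by
      refine setIntegral_mono_on (hK.const_mul _).integrableOn
        ((hint _ _).const_mul _).integrableOn measurableSet_Ioc fun v hv ↦ ?_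
      rw [← mul_assoc, mul_comm (exp _)]
      refine mul_le_mul_of_nonneg_right (hle ?_ ?_) (hK0 v)
      · have : v / (M / d) ≤ d := by
          rw [div_le_iff₀ (by positivity)]; field_simp; linarith [hv.2]
        linarith
      · have : -d ≤ v / (M / d) := by
          rw [le_div_iff₀ (by positivity)]; field_simp; linarith [hv.1]
        linarith
    have h5 : ∫ v in Ioc (-M) M, H (t + d - v / (M / d)) * K v ≤
        ∫ v, H (t + d - v / (M / d)) * K v :=
      setIntegral_le_integral (hint _ _) (ae_of_all _ fun v ↦ mul_nonneg (hH0 _) (hK0 _))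
    rw [integral_const_mul, integral_const_mul] at hlb
    have h6 : H t * B < B * a := by
      have := mul_le_mul_of_nonneg_left h5 (exp_pos (2 * d)).le
      linarith
    nlinarith

theorem integral_mul_fejerKernel_eq {f : ℝ → ℂ} {B : ℝ} (hf : Measurable f)
    (hB : ∀ u, ‖f u‖ ≤ B) (r t : ℝ) {σ : ℝ} (hσ : 0 < σ) :
    ∫ u in Ioi (0 : ℝ), f u * Complex.exp (-σ * u) * fejerKernel (r * (t - u)) =
      ∫ y in Icc (-1 : ℝ) 1, ((1 - |y| : ℝ) : ℂ) * Complex.exp (r * t * y * Complex.I) *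
        ∫ u in Ioi (0 : ℝ), f u * Complex.exp (-(σ + r * y * Complex.I) * u) := by
  have hexp : IntegrableOn (fun u : ℝ ↦ f u * Complex.exp (-σ * u)) (Ioi 0) := by
    refine Integrable.bdd_mul (c := B) ?_ hf.aestronglyMeasurable (ae_of_all _ hB)
    exact integrableOn_exp_mul_complex_Ioi (by simpa using hσ) 0
  have hΔ : IntegrableOn (fun y : ℝ ↦ ((1 - |y| : ℝ) : ℂ)) (Icc (-1) 1) :=
    (by fun_prop : Continuous fun y : ℝ ↦ ((1 - |y| : ℝ) : ℂ)).continuousOn.integrableOn_Icc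
  have hprod : Integrable (Function.uncurry fun u y : ℝ ↦
      Complex.exp (r * (t - u) * y * Complex.I) *
        (f u * Complex.exp (-σ * u) * ((1 - |y| : ℝ) : ℂ)))
      ((volume.restrict (Ioi 0)).prod (volume.restrict (Icc (-1) 1))) := by
    refine Integrable.bdd_mul (c := 1) (hexp.mul_prod hΔ) ?_ (ae_of_all _ fun p ↦ ?_)
    · exact Continuous.aestronglyMeasurable (by fun_prop)
    · have : (r : ℂ) * (t - p.1) * p.2 * Complex.I = ((r * (t - p.1) * p.2 : ℝ) : ℂ) * Complex.I := by
        push_cast; ring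
      rw [this, Complex.norm_exp_ofReal_mul_I]
  calc
    _ = ∫ u in Ioi (0 : ℝ), ∫ y in Icc (-1 : ℝ) 1, Complex.exp (r * (t - u) * y * Complex.I) *
        (f u * Complex.exp (-σ * u) * ((1 - |y| : ℝ) : ℂ)) := by
      refine integral_congr_ae (ae_of_all _ fun u ↦ ?_)
      simp only
      rw [fejerKernel_eq_integral, ← integral_const_mul]
      refine integral_congr_ae (ae_of_all _ fun y ↦ ?_)
      push_cast
      ring
    _ = ∫ y in Icc (-1 : ℝ) 1, ∫ u in Ioi (0 : ℝ), Complex.exp (r * (t - u) * y * Complex.I) *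
        (f u * Complex.exp (-σ * u) * ((1 - |y| : ℝ) : ℂ)) := integral_integral_swap hprod
    _ = _ := by
      refine integral_congr_ae (ae_of_all _ fun y ↦ ?_)
      simp only
      rw [← integral_const_mul]
      refine integral_congr_ae (ae_of_all _ fun u ↦ ?_)
      have h1 : Complex.exp (r * (t - u) * y * Complex.I) * Complex.exp (-σ * u) =
          Complex.exp (r * t * y * Complex.I) *
            Complex.exp (-(σ + r * y * Complex.I) * u) := by
        rw [← Complex.exp_add, ← Complex.exp_add]; ring_nf
      linear_combination (f u * ((1 - |y| : ℝ) : ℂ)) * h1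

theorem integral_mul_fejerKernel_eq_of_continuousOn {f : ℝ → ℂ} {B : ℝ} (hf : Measurable f)
    (hB : ∀ u, ‖f u‖ ≤ B) {G : ℂ → ℂ} (hG : ContinuousOn G {z | 0 ≤ z.re})
    (hfG : ∀ z : ℂ, 0 < z.re → ∫ u in Ioi (0 : ℝ), f u * Complex.exp (-z * u) = G z)
    {r : ℝ} (hr : 0 < r) (t : ℝ) :
    ∫ u in Ioi (0 : ℝ), f u * fejerKernel (r * (t - u)) =
      ∫ y in Icc (-1 : ℝ) 1, ((1 - |y| : ℝ) : ℂ) * Complex.exp (r * t * y * Complex.I) *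
        G (r * y * Complex.I) := by
  have hKint : Integrable fun u ↦ fejerKernel (r * (t - u)) :=
    (integrable_fejerKernel.comp_mul_left' hr.ne').comp_sub_left t
  have hl : Tendsto (fun σ : ℝ ↦
      ∫ u in Ioi (0 : ℝ), f u * Complex.exp (-σ * u) * fejerKernel (r * (t - u))) (𝓝[>] 0)
      (𝓝 (∫ u in Ioi (0 : ℝ), f u * fejerKernel (r * (t - u)))) := by
    refine tendsto_integral_filter_of_dominated_convergence
      (fun u ↦ B * fejerKernel (r * (t - u))) (Eventually.of_forall fun σ ↦ ?_) ?_
      (hKint.const_mul B).integrableOn (ae_of_all _ fun u ↦ ?_)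
    · have := continuous_fejerKernel
      exact ((hf.mul (by fun_prop)).mul (by fun_prop)).aestronglyMeasurable
    · filter_upwards [self_mem_nhdsWithin] with σ hσ
      filter_upwards [ae_restrict_mem measurableSet_Ioi] with u hu
      have hσ : 0 < σ := hσ
      have hu : 0 < u := hu
      rw [norm_mul, norm_mul, Complex.norm_real, norm_of_nonneg (fejerKernel_nonneg _)]
      refine mul_le_mul_of_nonneg_right ?_ (fejerKernel_nonneg _)
      have h1 : ‖Complex.exp (-σ * u)‖ ≤ 1 := by
        rw [Complex.norm_exp]
        have : (-(σ : ℂ) * u).re = -(σ * u) := by simp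
        rw [this, exp_le_one_iff]
        have := mul_pos hσ hu
        linarith
      calc _ ≤ ‖f u‖ * 1 := by gcongr
        _ ≤ B := by simpa using hB u
    · refine tendsto_nhdsWithin_of_tendsto_nhds ?_
      have : Continuous fun σ : ℝ ↦
          f u * Complex.exp (-σ * u) * fejerKernel (r * (t - u)) := by fun_prop
      simpa using this.tendsto 0
  have hGc : ContinuousOn (fun p : ℝ × ℝ ↦ G (p.1 + r * p.2 * Complex.I))
      (Icc 0 1 ×ˢ Icc (-1) 1) := by
    refine hG.comp (by fun_prop) fun p hp ↦ ?_
    simpa using hp.1.1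
  obtain ⟨D, hD⟩ := (isCompact_Icc.prod isCompact_Icc).exists_bound_of_continuousOn hGc
  have hR : Tendsto (fun σ : ℝ ↦ ∫ y in Icc (-1 : ℝ) 1, ((1 - |y| : ℝ) : ℂ) *
      Complex.exp (r * t * y * Complex.I) * G (σ + r * y * Complex.I)) (𝓝[>] 0)
      (𝓝 (∫ y in Icc (-1 : ℝ) 1, ((1 - |y| : ℝ) : ℂ) *
        Complex.exp (r * t * y * Complex.I) * G (r * y * Complex.I))) := by
    have hσ01 : ∀ᶠ σ : ℝ in 𝓝[>] 0, σ ∈ Icc (0 : ℝ) 1 := by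
      filter_upwards [Ioc_mem_nhdsGT one_pos] with σ hσ using Ioc_subset_Icc_self hσ
    refine tendsto_integral_filter_of_dominated_convergence (fun _ ↦ D) ?_ ?_
      (by simp) ?_
    · filter_upwards [hσ01] with σ hσ
      refine ContinuousOn.aestronglyMeasurable ?_ measurableSet_Icc
      refine ContinuousOn.mul (by fun_prop) (hG.comp (by fun_prop) fun y hy ↦ ?_)
      simpa using hσ.1
    · filter_upwards [hσ01] with σ hσ
      filter_upwards [ae_restrict_mem measurableSet_Icc] with y hy
      have h1 : (r : ℂ) * t * y * Complex.I = ((r * t * y : ℝ) : ℂ) * Complex.I := by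
        push_cast; ring
      have h2 := hD (σ, y) ⟨hσ, hy⟩
      have h3 : |y| ≤ 1 := abs_le.2 hy
      rw [norm_mul, norm_mul, h1, Complex.norm_exp_ofReal_mul_I, Complex.norm_real,
        norm_of_nonneg (by linarith), mul_one]
      have := abs_nonneg y
      calc _ ≤ 1 * ‖G (σ + r * y * Complex.I)‖ := by gcongr; linarith
        _ ≤ D := by simpa using h2
    · filter_upwards [ae_restrict_mem measurableSet_Icc] with y hy
      refine tendsto_const_nhds.mul ?_
      have h0 : Tendsto G (𝓝[{z | 0 ≤ z.re}] (r * y * Complex.I)) (𝓝 (G (r * y * Complex.I))) :=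
        hG (r * y * Complex.I) (by simp)
      refine h0.comp (tendsto_nhdsWithin_iff.2 ⟨tendsto_nhdsWithin_of_tendsto_nhds ?_, ?_⟩)
      · have : Continuous fun σ : ℝ ↦ (σ : ℂ) + r * y * Complex.I := by fun_prop
        simpa using this.tendsto 0
      · filter_upwards [hσ01] with σ hσ
        simpa using hσ.1
  refine tendsto_nhds_unique (hl.congr' ?_) hR
  filter_upwards [self_mem_nhdsWithin] with σ hσ
  have hσ : 0 < σ := hσ
  rw [integral_mul_fejerKernel_eq hf hB r t hσ]
  refine integral_congr_ae (ae_of_all _ fun y ↦ ?_)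
  simp only
  rw [hfG _ (by simpa using hσ)]

theorem tendsto_integral_mul_fejerKernel {f : ℝ → ℂ} {B : ℝ} (hf : Measurable f)
    (hB : ∀ u, ‖f u‖ ≤ B) {G : ℂ → ℂ} (hG : ContinuousOn G {z | 0 ≤ z.re})
    (hfG : ∀ z : ℂ, 0 < z.re → ∫ u in Ioi (0 : ℝ), f u * Complex.exp (-z * u) = G z)
    {r : ℝ} (hr : 0 < r) :
    Tendsto (fun t ↦ ∫ u in Ioi (0 : ℝ), f u * fejerKernel (r * (t - u))) atTop (𝓝 0) := by
  have h1 : Tendsto (fun t : ℝ ↦ -(r / (2 * π)) * t) atTop (cocompact ℝ) :=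
    (tendsto_id.const_mul_atTop_of_neg (by simp; positivity)).mono_right atBot_le_cocompact
  refine ((Real.tendsto_integral_exp_smul_cocompact ((Icc (-1 : ℝ) 1).indicator fun y ↦
    ((1 - |y| : ℝ) : ℂ) * G (r * y * Complex.I))).comp h1).congr fun t ↦ ?_
  rw [integral_mul_fejerKernel_eq_of_continuousOn hf hB hG hfG hr,
    ← integral_indicator measurableSet_Icc]
  refine integral_congr_ae (ae_of_all _ fun y ↦ ?_)
  by_cases hy : y ∈ Icc (-1 : ℝ) 1
  · simp only [indicator_of_mem hy, Circle.smul_def, Real.fourierChar_apply, smul_eq_mul]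
    have : ((2 * π * -(y * (-(r / (2 * π)) * t)) : ℝ) : ℂ) * Complex.I = r * t * y * Complex.I := by
      push_cast
      have : (π : ℂ) ≠ 0 := by exact_mod_cast pi_ne_zero
      field_simp
    rw [this]
    ring
  · simp [indicator_of_notMem hy]

/-- A **Wiener–Ikehara** type Tauberian theorem: boundedness and monotonicity of `H u * exp u`,
together with a continuous extension of the Laplace transform of `H - 1` to the closed right
half-plane, force `H` to tend to `1`. -/
theorem tendsto_one_of_laplace_continuousOn {H : ℝ → ℝ} {C : ℝ} (hH0 : ∀ u, 0 ≤ H u)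
    (hHC : ∀ u, H u ≤ C) (hHneg : ∀ u ≤ 0, H u = 0) (hmono : Monotone fun u ↦ H u * exp u)
    {G : ℂ → ℂ} (hG : ContinuousOn G {z | 0 ≤ z.re})
    (hHG : ∀ z : ℂ, 0 < z.re →
      ∫ u in Ioi (0 : ℝ), ((H u - 1 : ℝ) : ℂ) * Complex.exp (-z * u) = G z) :
    Tendsto H atTop (𝓝 1) := by
  refine tendsto_one_of_tendsto_kernel_average integrable_fejerKernel fejerKernel_nonneg
    integral_fejerKernel_pos hH0 hHC hmono fun r hr ↦ ?_
  have hHm : Measurable H := by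
    have : H = fun u ↦ (H u * exp u) * exp (-u) := by
      ext u; rw [mul_assoc, ← exp_add]; simp
    rw [this]
    exact hmono.measurable.mul (by fun_prop)
  have hB (u : ℝ) : ‖((H u - 1 : ℝ) : ℂ)‖ ≤ C + 1 := by
    rw [Complex.norm_real, norm_eq_abs, abs_le]
    constructor <;> linarith [hH0 u, hHC u]
  have h1 := tendsto_integral_mul_fejerKernel (f := fun u ↦ ((H u - 1 : ℝ) : ℂ))
    (by fun_prop) hB hG hHG hr
  have h2 : Tendsto (fun t ↦ r * ∫ u in Ioi (0 : ℝ), (H u - 1) * fejerKernel (r * (t - u)))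
      atTop (𝓝 0) := by
    have h := (Complex.continuous_re.tendsto 0).comp h1
    rw [Complex.zero_re] at h
    have h' := h.const_mul r
    rw [mul_zero] at h'
    refine h'.congr fun t ↦ ?_
    simp only [Function.comp_apply, ← Complex.ofReal_mul]
    rw [integral_complex_ofReal, Complex.ofReal_re]
  have hone : Measurable ((Ioi (0 : ℝ)).indicator fun _ ↦ (1 : ℝ)) :=
    measurable_const.indicator measurableSet_Ioi
  have h3 : Tendsto (fun t ↦ ∫ v, (Ioi (0 : ℝ)).indicator (fun _ ↦ 1) (t - v / r) * fejerKernel v)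
      atTop (𝓝 (∫ v, fejerKernel v)) := by
    refine tendsto_integral_filter_of_dominated_convergence fejerKernel
      (Eventually.of_forall fun t ↦ ?_) (Eventually.of_forall fun t ↦ ae_of_all _ fun v ↦ ?_)
      integrable_fejerKernel (ae_of_all _ fun v ↦ ?_)
    · exact ((hone.comp (by fun_prop)).mul continuous_fejerKernel.measurable).aestronglyMeasurable
    · by_cases h : t - v / r ∈ Ioi (0 : ℝ)
      · rw [indicator_of_mem h, one_mul, norm_of_nonneg (fejerKernel_nonneg v)]
      · rw [indicator_of_notMem h, zero_mul, norm_zero]; exact fejerKernel_nonneg v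
    · refine tendsto_const_nhds.congr' ?_
      filter_upwards [eventually_gt_atTop (v / r)] with t ht
      rw [indicator_of_mem (by simpa using ht), one_mul]
  have hint (t : ℝ) : Integrable fun v ↦
      (Ioi (0 : ℝ)).indicator (fun _ ↦ 1) (t - v / r) * fejerKernel v := by
    refine integrable_fejerKernel.bdd_mul (c := 1) (hone.comp (by fun_prop)).aestronglyMeasurable
      (ae_of_all _ fun v ↦ ?_)
    exact (norm_indicator_le_norm_self _ _).trans (by simp)
  have hint' (t : ℝ) : Integrable fun v ↦ H (t - v / r) * fejerKernel v := by
    refine integrable_fejerKernel.bdd_mul (c := C) (hHm.comp (by fun_prop)).aestronglyMeasurable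
      (ae_of_all _ fun v ↦ ?_)
    rw [norm_of_nonneg (hH0 _)]
    exact hHC _
  have h4 := h2.add h3
  rw [zero_add] at h4
  refine h4.congr fun t ↦ ?_
  rw [← eq_sub_iff_add_eq, ← integral_sub (hint' t) (hint t),
    ← integral_indicator measurableSet_Ioi,
    ← integral_sub_left_eq_self _ volume t]
  have h5 := Measure.integral_comp_mul_left (fun v ↦ H (t - v / r) * fejerKernel v -
    (Ioi (0 : ℝ)).indicator (fun _ ↦ 1) (t - v / r) * fejerKernel v) r
  rw [abs_of_pos (inv_pos.2 hr), smul_eq_mul, eq_inv_mul_iff_mul_eq₀ hr.ne'] at h5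
  rw [← h5]
  congr 1
  refine integral_congr_ae (ae_of_all _ fun v ↦ ?_)
  simp only [mul_div_cancel_left₀ v hr.ne', indicator, mem_Ioi, sub_sub_cancel]
  split_ifs with h
  · ring
  · rw [hHneg _ (not_lt.1 h)]; ring

theorem laplace_psi_exp_sub_one {z : ℂ} (hz : 0 < z.re) :
    ∫ u in Ioi (0 : ℝ), ((Chebyshev.psi (exp u) * exp (-u) - 1 : ℝ) : ℂ) * Complex.exp (-z * u) =
      (ArithmeticFunction.vonMangoldt.LFunctionResidueClassAux (1 : ZMod 1) (1 + z) - 1) /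
        (1 + z) := by
  have hs : 1 < (1 + z).re := by simpa using hz
  have hz0 : z ≠ 0 := fun h ↦ by simp [h] at hz
  have hz1 : 1 + z ≠ 0 := fun h ↦ by rw [h] at hs; norm_num at hs
  have hL : LSeries (fun n ↦ (ArithmeticFunction.vonMangoldt n : ℂ)) (1 + z) =
      (1 + z) * ∫ u in Ioi (0 : ℝ),
        ((Chebyshev.psi (exp u) * exp (-u) : ℝ) : ℂ) * Complex.exp (-z * u) := by
    rw [LSeries_eq_mul_integral_of_nonneg (fun n ↦ ArithmeticFunction.vonMangoldt n) zero_le_one hs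
      ?_ fun n ↦ ArithmeticFunction.vonMangoldt_nonneg]
    · congr 1
      have himg : exp '' Ioi 0 = Ioi 1 := by
        ext x
        simp only [mem_image, mem_Ioi]
        refine ⟨?_, fun hx ↦ ⟨log x, log_pos hx, exp_log (by linarith)⟩⟩
        rintro ⟨u, hu, rfl⟩
        exact one_lt_exp_iff.2 hu
      rw [← himg, integral_image_eq_integral_abs_deriv_smul measurableSet_Ioi
        (fun u _ ↦ (hasDerivAt_exp u).hasDerivWithinAt) exp_injective.injOn]
      refine integral_congr_ae (ae_of_all _ fun u ↦ ?_)
      have hpsi : ∑ k ∈ Finset.Icc 1 ⌊exp u⌋₊, (ArithmeticFunction.vonMangoldt k : ℂ) =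
          Chebyshev.psi (exp u) := by
        rw [Chebyshev.psi, ← Finset.Icc_add_one_left_eq_Ioc]
        push_cast
        rfl
      have hpow : ((exp u : ℝ) : ℂ) ^ (-(1 + z + 1)) = Complex.exp (-(1 + z + 1) * u) := by
        rw [Complex.cpow_def_of_ne_zero (by exact_mod_cast (exp_pos u).ne'),
          ← Complex.ofReal_log (exp_pos u).le, log_exp, mul_comm]
      simp only [hpsi, hpow, abs_of_pos (exp_pos u), Complex.real_smul]
      push_cast
      have : Complex.exp u * Complex.exp (-(1 + z + 1) * u) =
          Complex.exp (-u) * Complex.exp (-z * u) := by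
        rw [← Complex.exp_add, ← Complex.exp_add]; ring_nf
      linear_combination (Chebyshev.psi (exp u) : ℂ) * this
    · refine Asymptotics.IsBigO.of_bound (log 4 + 4) (Eventually.of_forall fun n ↦ ?_)
      have : ∑ k ∈ Finset.Icc 1 n, ArithmeticFunction.vonMangoldt k = Chebyshev.psi n := by
        rw [Chebyshev.psi, ← Finset.Icc_add_one_left_eq_Ioc, Nat.floor_natCast]
        rfl
      rw [this, norm_of_nonneg (Chebyshev.psi_nonneg _), rpow_one, norm_of_nonneg (by positivity)]
      exact Chebyshev.psi_le_const_mul_self (by positivity)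
  have hAux := ArithmeticFunction.vonMangoldt.eqOn_LFunctionResidueClassAux
    (q := 1) (a := 1) isUnit_one hs
  have hres : ArithmeticFunction.vonMangoldt.residueClass (1 : ZMod 1) =
      fun n ↦ ArithmeticFunction.vonMangoldt n := by
    ext n
    simp [ArithmeticFunction.vonMangoldt.residueClass, Subsingleton.elim (n : ZMod 1) 1]
  simp only [hres, Nat.totient_one, Nat.cast_one, inv_one, add_sub_cancel_left] at hAux
  have hexp : IntegrableOn (fun u : ℝ ↦ Complex.exp (-z * u)) (Ioi 0) :=
    integrableOn_exp_mul_complex_Ioi (by simpa using hz) 0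
  have hpsi : IntegrableOn (fun u : ℝ ↦
      ((Chebyshev.psi (exp u) * exp (-u) : ℝ) : ℂ) * Complex.exp (-z * u)) (Ioi 0) := by
    refine Integrable.bdd_mul (c := log 4 + 4) hexp ?_ (ae_of_all _ fun u ↦ ?_)
    · have := Chebyshev.psi_mono.measurable
      exact Measurable.aestronglyMeasurable (by fun_prop)
    · rw [Complex.norm_real, norm_of_nonneg (by positivity), exp_neg, ← div_eq_mul_inv,
        div_le_iff₀ (exp_pos u)]
      exact Chebyshev.psi_le_const_mul_self (exp_pos u).le
  have hone : ∫ u in Ioi (0 : ℝ), Complex.exp (-z * u) = 1 / z := by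
    rw [integral_exp_mul_complex_Ioi (by simpa using hz)]
    simp
  have hsub : ∫ u in Ioi (0 : ℝ),
      ((Chebyshev.psi (exp u) * exp (-u) - 1 : ℝ) : ℂ) * Complex.exp (-z * u) =
      (∫ u in Ioi (0 : ℝ),
        ((Chebyshev.psi (exp u) * exp (-u) : ℝ) : ℂ) * Complex.exp (-z * u)) - 1 / z := by
    rw [← hone, ← integral_sub hpsi hexp]
    refine integral_congr_ae (ae_of_all _ fun u ↦ ?_)
    push_cast
    ring
  rw [hsub, hAux, hL]
  field_simp
  ring

/-- The **prime number theorem** for the Chebyshev function `ψ`. -/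
theorem tendsto_psi_div_self : Tendsto (fun x ↦ Chebyshev.psi x / x) atTop (𝓝 1) := by
  have hG : ContinuousOn (fun z : ℂ ↦
      (ArithmeticFunction.vonMangoldt.LFunctionResidueClassAux (1 : ZMod 1) (1 + z) - 1) / (1 + z))
      {z | 0 ≤ z.re} := by
    refine ContinuousOn.div (ContinuousOn.sub ?_ continuousOn_const) (by fun_prop) fun z hz h ↦ ?_
    · refine (ArithmeticFunction.vonMangoldt.continuousOn_LFunctionResidueClassAux
        (1 : ZMod 1)).comp (by fun_prop) fun z hz ↦ ?_
      simpa using hz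
    · have h1 := congrArg Complex.re h
      have hz : 0 ≤ z.re := hz
      simp only [Complex.add_re, Complex.one_re, Complex.zero_re] at h1
      linarith
  have h := tendsto_one_of_laplace_continuousOn (H := fun u ↦ Chebyshev.psi (exp u) * exp (-u))
    (C := log 4 + 4) (fun u ↦ by positivity) (fun u ↦ ?_) (fun u hu ↦ ?_) ?_ hG
    fun z hz ↦ laplace_psi_exp_sub_one hz
  · refine (h.comp tendsto_log_atTop).congr' ?_
    filter_upwards [eventually_gt_atTop 0] with x hx
    simp [exp_log hx, exp_neg, div_eq_mul_inv]
  · rw [exp_neg, ← div_eq_mul_inv, div_le_iff₀ (exp_pos u)]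
    exact Chebyshev.psi_le_const_mul_self (exp_pos u).le
  · rw [Chebyshev.psi_eq_zero_of_le_one (exp_le_one_iff.2 hu), zero_mul]
  · have : (fun u ↦ Chebyshev.psi (exp u) * exp (-u) * exp u) = Chebyshev.psi ∘ exp := by
      ext u
      rw [mul_assoc, ← exp_add]
      simp
    rw [this]
    exact Chebyshev.psi_mono.comp exp_monotone

theorem tendsto_theta_div_self : Tendsto (fun x ↦ Chebyshev.theta x / x) atTop (𝓝 1) := by
  have h1 : (Chebyshev.psi - Chebyshev.theta) =o[atTop] fun x : ℝ ↦ x := by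
    refine Chebyshev.isBigO_psi_sub_theta_sqrt.trans_isLittleO <|
      Asymptotics.isLittleO_of_tendsto (fun x hx ↦ by simp [hx]) ?_
    simpa only [sqrt_div_self, Function.comp_def] using
      tendsto_inv_atTop_zero.comp tendsto_sqrt_atTop
  have h2 := tendsto_psi_div_self.sub h1.tendsto_div_nhds_zero
  rw [sub_zero] at h2
  refine h2.congr fun x ↦ ?_
  rw [Pi.sub_apply]
  ring

/-- The **prime number theorem**. -/
theorem tendsto_primeCounting_mul_log_div_self :
    Tendsto (fun x : ℝ ↦ (Nat.primeCounting ⌊x⌋₊ : ℝ) * log x / x) atTop (𝓝 1) := by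
  have h1 : (fun x : ℝ ↦ Nat.primeCounting ⌊x⌋₊ - Chebyshev.theta x / log x) =o[atTop]
      fun x ↦ x / log x := by
    refine Chebyshev.primeCounting_sub_theta_div_log_isBigO.trans_isLittleO ?_
    refine Asymptotics.isLittleO_iff_tendsto' (by simp) |>.mpr ?_
    refine tendsto_log_atTop.inv_tendsto_atTop.congr' ?_
    filter_upwards [eventually_gt_atTop 0] with x _
    simp only [Pi.inv_apply]
    field
  have h2 := h1.tendsto_div_nhds_zero.add tendsto_theta_div_self
  rw [zero_add] at h2
  refine h2.congr' ?_
  filter_upwards [eventually_gt_atTop 1] with x hx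
  have := log_pos hx
  field_simp
  ring

theorem tendsto_log_div_log_of_tendsto_div {α : Type*} {l : Filter α} {x y : α → ℝ} (m : ℤ)
    (hy : Tendsto y l atTop) (h : Tendsto (fun a ↦ x a / (y a * log (y a) ^ m)) l (𝓝 1)) :
    Tendsto (fun a ↦ log (x a) / log (y a)) l (𝓝 1) := by
  have hly := tendsto_log_atTop.comp hy
  have h1 : Tendsto (fun a ↦ log (x a / (y a * log (y a) ^ m)) / log (y a)) l (𝓝 0) := by
    have h := (continuousAt_log one_ne_zero).tendsto.comp h
    exact h.div_atTop hly
  have h2 : Tendsto (fun a ↦ log (log (y a)) / log (y a)) l (𝓝 0) :=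
    isLittleO_log_id_atTop.tendsto_div_nhds_zero.comp hly
  have h3 := (h1.add (h2.const_mul (m : ℝ))).const_add 1
  rw [mul_zero, add_zero, add_zero] at h3
  refine h3.congr' ?_
  filter_upwards [hy.eventually_gt_atTop 1, h.eventually (lt_mem_nhds one_pos)] with a ha hxa
  have hl := log_pos ha
  have hx : x a ≠ 0 := by intro h0; simp [h0] at hxa
  rw [log_div hx (by positivity), log_mul (by positivity) (by positivity), log_zpow]
  field_simp
  ring

theorem tendsto_nthPrime_atTop : Tendsto nthPrime atTop atTop :=
  (Nat.nth_strictMono Nat.infinite_setOfPred_prime).tendsto_atTop.comp (tendsto_sub_atTop_nat 1)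

theorem primeCounting_nthPrime {n : ℕ} (hn : 1 ≤ n) : Nat.primeCounting (nthPrime n) = n := by
  rw [nthPrime, Nat.primeCounting, Nat.primeCounting', Nat.count_nth_succ_of_infinite
    Nat.infinite_setOfPred_prime]
  omega

theorem tendsto_nthPrime_div_mul_log :
    Tendsto (fun n : ℕ ↦ (nthPrime n : ℝ) / (n * log n)) atTop (𝓝 1) := by
  have hP : Tendsto (fun n ↦ (nthPrime n : ℝ)) atTop atTop :=
    tendsto_natCast_atTop_atTop.comp tendsto_nthPrime_atTop
  have h1 : Tendsto (fun n : ℕ ↦ (n : ℝ) * log (nthPrime n) / nthPrime n) atTop (𝓝 1) := by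
    refine (tendsto_primeCounting_mul_log_div_self.comp hP).congr' ?_
    filter_upwards [eventually_ge_atTop 1] with n hn
    simp only [Function.comp_apply, Nat.floor_natCast, primeCounting_nthPrime hn]
  have h2 := tendsto_log_div_log_of_tendsto_div (x := fun n : ℕ ↦ (n : ℝ)) (-1) hP <| by
    refine h1.congr fun n ↦ ?_
    rw [zpow_neg_one, ← div_eq_mul_inv, div_div_eq_mul_div]
  have h3 := (h1.mul h2).inv₀ (by norm_num)
  rw [mul_one, inv_one] at h3
  refine h3.congr' ?_
  filter_upwards [hP.eventually_gt_atTop 1] with n hn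
  have := log_pos hn
  field_simp

/-- For fixed `k ≥ 1`, `q^k(n) ~ n·(log n)^k` as `n → ∞`. -/
theorem pip_order_k_asymptotic (k : ℕ) (hk : 1 ≤ k) :
    Tendsto (fun n : ℕ => (q k n : ℝ) / (n * (Real.log n) ^ k))
      atTop (nhds 1) := by
  have hlog : Tendsto (fun n : ℕ ↦ (n : ℝ)) atTop atTop := tendsto_natCast_atTop_atTop
  clear hk
  induction k with
  | zero =>
    refine tendsto_const_nhds.congr' ?_
    filter_upwards [eventually_ne_atTop 0] with n hn
    have : (n : ℝ) ≠ 0 := by exact_mod_cast hn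
    simp [q, this]
  | succ k ih =>
    have hq : Tendsto (q k) atTop atTop := tendsto_nthPrime_atTop.iterate k
    have h1 := tendsto_nthPrime_div_mul_log.comp hq
    have h2 := tendsto_log_div_log_of_tendsto_div (x := fun n ↦ (q k n : ℝ)) k hlog
      (by simpa using ih)
    have h3 := (h1.mul ih).mul h2
    rw [mul_one, mul_one] at h3
    refine h3.congr' ?_
    filter_upwards [eventually_gt_atTop 1, hq.eventually_gt_atTop 1] with n hn hqn
    have hn' : (1 : ℝ) < n := by exact_mod_cast hn
    have hqn' : (1 : ℝ) < q k n := by exact_mod_cast hqn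
    have := log_pos hn'
    have := log_pos hqn'
    have hsucc : q (k + 1) n = nthPrime (q k n) := Function.iterate_succ_apply' _ _ _
    simp only [Function.comp_apply, hsucc]
    field_simp
    ring
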